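/- Let V be a real AOU space with its order norm, let f : V → ℝ be a linear functional, and let ε ≥ 0. Then f(x) ≥ −ε for all x ∈ V with 0 ≤ x ≤ e_V if and only if |f(v)| ≤ (2ε + f(e_V))·‖v‖ for all v ∈ V (equivalently, f is bounded with ‖f‖ ≤ 2ε + f(e_V)). -/

import Mathlib

open TensorProduct

/-- A real AOU space structure on a real vector space `V`: a proper cone together with
an Archimedean order unit. -/
structure AOU (V : Type*) [AddCommGroup V] [Module ℝ V] where
  pos : Set V
  unit : V
  zero_mem : (0 : V) ∈ pos
  add_mem : ∀ ⦃x y : V⦄, x ∈ pos → y ∈ pos → x + y ∈ pos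
  smul_mem : ∀ ⦃r : ℝ⦄, 0 ≤ r → ∀ ⦃x : V⦄, x ∈ pos → r • x ∈ pos
  proper : ∀ x : V, x ∈ pos → -x ∈ pos → x = 0
  exists_orderUnit : ∀ v : V, ∃ r : ℝ, 0 < r ∧ r • unit - v ∈ pos
  arch : ∀ v : V, (∀ ε : ℝ, 0 < ε → ε • unit + v ∈ pos) → v ∈ pos

variable {V W : Type*} [AddCommGroup V] [Module ℝ V] [AddCommGroup W] [Module ℝ W]

/-- A state on a real AOU space: a unital positive linear functional. -/
def IsState (A : AOU V) (f : V →ₗ[ℝ] ℝ) : Prop :=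
  f A.unit = 1 ∧ ∀ v ∈ A.pos, 0 ≤ f v

/-- The tensor product functional `f ⊗ g` on `V ⊗ W`, with `(f ⊗ g)(v ⊗ w) = f v * g w`. -/
noncomputable def tensFun (f : V →ₗ[ℝ] ℝ) (g : W →ₗ[ℝ] ℝ) :
    TensorProduct ℝ V W →ₗ[ℝ] ℝ :=
  TensorProduct.lift (f.smulRight g)

/-- The injective cone `(V ⊗_ε W)⁺`. -/
def injCone (A : AOU V) (B : AOU W) : Set (TensorProduct ℝ V W) :=
  {z | ∀ (f : V →ₗ[ℝ] ℝ) (g : W →ₗ[ℝ] ℝ), IsState A f → IsState B g → 0 ≤ tensFun f g z}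

/-- The set `V⁺ ⊗ W⁺` of finite sums of elementary tensors of positive elements. -/
def simpleCone (A : AOU V) (B : AOU W) : Set (TensorProduct ℝ V W) :=
  {z | ∃ (n : ℕ) (v : Fin n → V) (w : Fin n → W),
    (∀ i, v i ∈ A.pos) ∧ (∀ i, w i ∈ B.pos) ∧ z = ∑ i, v i ⊗ₜ[ℝ] w i}

/-- The projective cone `(V ⊗_π W)⁺`. -/
def projCone (A : AOU V) (B : AOU W) : Set (TensorProduct ℝ V W) :=
  {z | ∀ ε : ℝ, 0 < ε → z + ε • (A.unit ⊗ₜ[ℝ] B.unit) ∈ simpleCone A B}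

/-- The order norm determined by a cone `pos` and order unit `e`. -/
noncomputable def gNorm {X : Type*} [AddCommGroup X] [Module ℝ X]
    (pos : Set X) (e : X) (x : X) : ℝ :=
  sInf {r : ℝ | 0 < r ∧ r • e - x ∈ pos ∧ r • e + x ∈ pos}

namespace AOU

theorem unit_mem (A : AOU V) : A.unit ∈ A.pos := by
  obtain ⟨r, hr, h⟩ := A.exists_orderUnit 0
  have h' := A.smul_mem (inv_nonneg.2 hr.le) h
  rwa [sub_zero, inv_smul_smul₀ hr.ne'] at h'

theorem exists_order_bound (A : AOU V) (v : V) :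
    ∃ r : ℝ, 0 < r ∧ r • A.unit - v ∈ A.pos ∧ r • A.unit + v ∈ A.pos := by
  obtain ⟨r, hr, h⟩ := A.exists_orderUnit v
  obtain ⟨s, hs, k⟩ := A.exists_orderUnit (-v)
  refine ⟨r + s, add_pos hr hs, ?_, ?_⟩
  · convert A.add_mem h (A.smul_mem hs.le A.unit_mem) using 1
    module
  · convert A.add_mem k (A.smul_mem hr.le A.unit_mem) using 1
    module

end AOU

theorem gNorm_nonneg {X : Type*} [AddCommGroup X] [Module ℝ X] (pos : Set X) (e x : X) :
    0 ≤ gNorm pos e x :=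
  Real.sInf_nonneg fun _ hr => hr.1.le

theorem gNorm_le {X : Type*} [AddCommGroup X] [Module ℝ X] {pos : Set X} {e x : X} {r : ℝ}
    (hr : 0 < r) (hsub : r • e - x ∈ pos) (hadd : r • e + x ∈ pos) : gNorm pos e x ≤ r :=
  csInf_le ⟨0, fun _ hs => hs.1.le⟩ ⟨hr, hsub, hadd⟩

/-- A functional bounded below by `-ε` on the order interval `[0, e]` satisfies
`-f v ≤ (2 * ε + f e) * r` whenever `-r e ≤ v ≤ r e`. -/
theorem neg_apply_le_of_order_bound (A : AOU V) (f : V →ₗ[ℝ] ℝ) {ε : ℝ}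
    (h : ∀ x : V, x ∈ A.pos → A.unit - x ∈ A.pos → -ε ≤ f x) {v : V} {r : ℝ} (hr : 0 < r)
    (hsub : r • A.unit - v ∈ A.pos) (hadd : r • A.unit + v ∈ A.pos) :
    -f v ≤ (2 * ε + f A.unit) * r := by
  have hc : 0 ≤ (2 * r)⁻¹ := by positivity
  have hx := h ((2 * r)⁻¹ • (r • A.unit + v)) (A.smul_mem hc hadd) (by
    convert A.smul_mem hc hsub using 1
    match_scalars
    · field_simp
      norm_num
    · field_simp)
  simp only [map_smul, map_add, smul_eq_mul] at hx
  rw [← div_eq_inv_mul, le_div_iff₀ (by positivity)] at hx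
  linarith

/-- for a linear functional `f` on a real AOU space and `ε ≥ 0`, one has
`f(x) ≥ -ε` for all `0 ≤ x ≤ e` if and only if `‖f‖ ≤ 2ε + f(e)`. -/
theorem functional_bound_iff (A : AOU V) (f : V →ₗ[ℝ] ℝ) (ε : ℝ) (hε : 0 ≤ ε) :
    (∀ x : V, x ∈ A.pos → A.unit - x ∈ A.pos → -ε ≤ f x) ↔
    (∀ v : V, |f v| ≤ (2 * ε + f A.unit) * gNorm A.pos A.unit v) := by
  constructor
  · intro h v
    have hK : 0 ≤ 2 * ε + f A.unit := by
      have := h A.unit A.unit_mem (by simpa using A.zero_mem)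
      linarith
    have hle : ∀ r : ℝ, 0 < r → r • A.unit - v ∈ A.pos → r • A.unit + v ∈ A.pos →
        |f v| ≤ (2 * ε + f A.unit) * r := by
      intro r hr hsub hadd
      have h₁ := neg_apply_le_of_order_bound A f h hr hsub hadd
      have h₂ := neg_apply_le_of_order_bound A f h (v := -v) hr
        (by simpa using hadd) (by simpa [← sub_eq_add_neg] using hsub)
      rw [map_neg, neg_neg] at h₂
      exact abs_le'.2 ⟨h₂, h₁⟩
    rcases hK.eq_or_lt with hK | hK
    · obtain ⟨r, hr, hsub, hadd⟩ := A.exists_order_bound v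
      have := hle r hr hsub hadd
      rw [← hK, zero_mul] at this ⊢
      exact this
    · rw [← div_le_iff₀' hK]
      exact le_csInf (A.exists_order_bound v) fun r hr =>
        (div_le_iff₀' hK).2 (hle r hr.1 hr.2.1 hr.2.2)
  · intro h x hx hx'
    have hK : 0 ≤ 2 * ε + f A.unit := by
      by_contra! hK
      have := mul_nonpos_of_nonpos_of_nonneg hK.le (gNorm_nonneg A.pos A.unit A.unit)
      linarith [h A.unit, neg_abs_le (f A.unit)]
    have hnorm : gNorm A.pos A.unit ((2 : ℝ) • x - A.unit) ≤ 1 := by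
      refine gNorm_le one_pos ?_ ?_
      · convert A.smul_mem zero_le_two hx' using 1
        module
      · convert A.smul_mem zero_le_two hx using 1
        module
    have hv := (h ((2 : ℝ) • x - A.unit)).trans (mul_le_of_le_one_right hK hnorm)
    have := neg_le_of_abs_le hv
    simp only [map_sub, map_smul, smul_eq_mul] at this
    linarith
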